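/- arXiv:1912.03917 — 9 statements merged into one kernel-verified Lean document; each statement's English description precedes it below -/
import Mathlib

section
/- Let R be a commutative ring and α ∈ R. The map sending a pair (u,v) ∈ R × R with u² − α·v² = 1 to the matrix !![u, α·v; v, u] is a bijection onto the set of 2×2 matrices A over R satisfying Aᵀ · diag(1, −α) · A = diag(1, −α) and det A = 1, and it is multiplicative: the pair-multiplication (u,v)·(u',v') = (u·u' + α·v·v', u·v' + v·u') (i.e., multiplication of norm-one elements u + v√α of R[√α]) corresponds to matrix multiplication. In particular, the special orthogonal group of the binary norm form x² − α·y² is isomorphic as a group to the norm-one group of R[X]/(X² − α). -/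
open Matrix

/-- **`SO` of the norm form equals the norm-one group** (functor of points, Lemma `N = O+`):
over any commutative ring `R` with `α ∈ R`, the map `(u, v) ↦ !![u, α·v; v, u]` is a
multiplicative bijection from the norm-one group `{(u,v) : u² - αv² = 1}` of `R[√α]`
onto the special orthogonal group `{A : Aᵀ·diag(1,-α)·A = diag(1,-α), det A = 1}`
of the norm form `x² - αy²`. -/
theorem so_normform_eq_norm_one_group (R : Type) [CommRing R] (α : R) :
    Set.BijOn (fun p : R × R => !![p.1, α * p.2; p.2, p.1])
      {p : R × R | p.1 ^ 2 - α * p.2 ^ 2 = 1}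
      {A : Matrix (Fin 2) (Fin 2) R |
        Aᵀ * !![(1 : R), 0; 0, -α] * A = !![(1 : R), 0; 0, -α] ∧ A.det = 1} ∧
    ∀ p p' : R × R,
      (fun p : R × R => !![p.1, α * p.2; p.2, p.1])
          (p.1 * p'.1 + α * p.2 * p'.2, p.1 * p'.2 + p.2 * p'.1) =
        (fun p : R × R => !![p.1, α * p.2; p.2, p.1]) p *
          (fun p : R × R => !![p.1, α * p.2; p.2, p.1]) p' := by
  refine ⟨⟨?_, ?_, ?_⟩, ?_⟩
  · rintro ⟨u, v⟩ h
    simp only [Set.mem_setOf_eq] at h ⊢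
    refine ⟨?_, ?_⟩
    · ext i j
      fin_cases i <;> fin_cases j <;> simp [Matrix.mul_apply, Fin.sum_univ_two]
      · linear_combination h
      · ring
      · ring
      · linear_combination (-α) * h
    · rw [Matrix.det_fin_two_of]
      linear_combination h
  · rintro ⟨u, v⟩ _ ⟨u', v'⟩ _ h
    have h0 := congrFun (congrFun h 0) 0
    have h1 := congrFun (congrFun h 1) 0
    simp at h0 h1
    rw [h0, h1]
  · rintro A ⟨hA, hd⟩
    have h0 := congrFun (congrFun hA 0) 0
    have h1 := congrFun (congrFun hA 0) 1
    simp [Matrix.mul_apply, Fin.sum_univ_two] at h0 h1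
    rw [Matrix.det_fin_two] at hd
    have e1 : A 0 0 = A 1 1 := by
      linear_combination A 1 1 * h0 - A 0 0 * hd - A 1 0 * h1
    have e2 : α * A 1 0 = A 0 1 := by
      linear_combination A 0 1 * h0 - A 0 0 * h1 - α * A 1 0 * hd
    refine ⟨(A 0 0, A 1 0), ?_, ?_⟩
    · simp only [Set.mem_setOf_eq]
      linear_combination h0
    · ext i j
      fin_cases i <;> fin_cases j <;> simp [e1, e2]
  · rintro ⟨u, v⟩ ⟨u', v'⟩
    ext i j
    fin_cases i <;> fin_cases j <;> simp [Matrix.mul_apply, Fin.sum_univ_two] <;> ring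
end

section
/- Let q be an odd prime power, α ∈ 𝔽_q[X], and O_K = 𝔽_q[X][√α] = AdjoinRoot(Y² − α). Let a, b, c ∈ 𝔽_q[X] satisfy (b/2)² − α = a·c and suppose the form is primitive, i.e., the ideal of 𝔽_q[X] generated by a, b, c is the unit ideal. Then in O_K one has the equality of ideals (a, b/2 − √α) · (a, b/2 + √α) = (a), i.e., Ideal.span {a, b/2 − √α} * Ideal.span {a, b/2 + √α} = Ideal.span {a}. -/
open Polynomial Matrix
open scoped nonZeroDivisors

noncomputable section

/-- The coefficient `b/2` (2 is invertible in `F`). -/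
def half (F : Type) [Field F] (b : Polynomial F) : Polynomial F :=
  Polynomial.C (2⁻¹ : F) * b

/-- The Gram matrix `!![a, b/2; b/2, c]` of the binary quadratic form `(a, b, c)`. -/
def gram (F : Type) [Field F] (f : Polynomial F × Polynomial F × Polynomial F) :
    Matrix (Fin 2) (Fin 2) (Polynomial F) :=
  !![f.1, half F f.2.1; half F f.2.1, f.2.2]

/-- Proper equivalence of binary quadratic forms over `F[X]`:
congruence of Gram matrices by a matrix whose determinant is the square of a unit of `F`. -/
def ProperEquiv (F : Type) [Field F] (f g : Polynomial F × Polynomial F × Polynomial F) : Prop :=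
  ∃ A : Matrix (Fin 2) (Fin 2) (Polynomial F),
    (∃ u : Fˣ, A.det = Polynomial.C ((u : F) ^ 2)) ∧ Aᵀ * gram F f * A = gram F g

/-- A binary form is positive definite with respect to `α` if over some finite flat
`F[X]`-algebra `R` its Gram matrix is congruent to `diag(1, -α)` by a matrix whose
determinant is the image of a square of a unit of `F`. -/
def PosDefWrt (F : Type) [Field F] (α : Polynomial F)
    (f : Polynomial F × Polynomial F × Polynomial F) : Prop :=
  ∃ (R : Type) (_ : CommRing R) (_ : Algebra (Polynomial F) R),
    Module.Finite (Polynomial F) R ∧ Module.Flat (Polynomial F) R ∧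
    ∃ A : Matrix (Fin 2) (Fin 2) R,
      (∃ u : Fˣ, A.det = algebraMap (Polynomial F) R (Polynomial.C ((u : F) ^ 2))) ∧
      (gram F f).map (algebraMap (Polynomial F) R) =
        Aᵀ * !![(1 : R), 0; 0, -(algebraMap (Polynomial F) R α)] * A

/-- `O_K = F[X][√α] = AdjoinRoot (Y² - α)`. -/
abbrev OK (F : Type) [Field F] (α : Polynomial F) : Type :=
  AdjoinRoot ((Polynomial.X : Polynomial (Polynomial F)) ^ 2 - Polynomial.C α)

/-- The ideal `(a, b/2 - √α)` of `O_K`. -/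
def idealOf (F : Type) [Field F] (α a b : Polynomial F) : Ideal (OK F α) :=
  Ideal.span {AdjoinRoot.of _ a, AdjoinRoot.of _ (half F b) - AdjoinRoot.root _}

/-- `cl₁(α)`: proper-isomorphism classes of binary forms positive definite w.r.t. `α`. -/
def Cl1 (F : Type) [Field F] (α : Polynomial F) : Type :=
  Quot (fun f g : {f : Polynomial F × Polynomial F × Polynomial F // PosDefWrt F α f} =>
    ProperEquiv F f.1 g.1)

/-- `K = F(X)(√α)` is imaginary. -/
def Imaginary (F : Type) [Field F] (α : Polynomial F) : Prop :=
  Odd α.natDegree ∨ (Even α.natDegree ∧ ¬ IsSquare α.leadingCoeff)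


/-- **The product of the ideals of a form and its opposite is principal** (Remark `opposite`):
if `(b/2)² - α = a·c` and `(a, b, c)` is primitive, then in `O_K = 𝔽_q[X][√α]` one has
`(a, b/2 - √α) · (a, b/2 + √α) = (a)`. -/
theorem ideal_mul_opposite_eq_principal (F : Type) [Field F] [Fintype F]
    (hodd : Odd (Fintype.card F)) (α : Polynomial F) (a b c : Polynomial F)
    (habc : (half F b) ^ 2 - α = a * c)
    (hprim : Ideal.span {a, b, c} = (⊤ : Ideal (Polynomial F))) :
    Ideal.span {AdjoinRoot.of _ a, AdjoinRoot.of _ (half F b) - AdjoinRoot.root _} *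
        Ideal.span {AdjoinRoot.of _ a, AdjoinRoot.of _ (half F b) + AdjoinRoot.root _} =
      Ideal.span {(AdjoinRoot.of _ a : OK F α)} := by
  have h2 : (2 : F) ≠ 0 := by
    intro h
    have h3 : ringChar F = 2 := by
      have h4 : ringChar F ∣ 2 := by
        exact ringChar.dvd (by exact_mod_cast h)
      exact (Nat.prime_dvd_prime_iff_eq (CharP.char_is_prime F (ringChar F)) Nat.prime_two).1 h4
    have h5 := FiniteField.even_card_of_char_two h3
    rcases hodd with ⟨k, hk⟩
    omega
  have hb : b = half F b + half F b := by
    unfold half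
    rw [← add_mul, ← C_add, ← two_mul, mul_inv_cancel₀ h2, C_1, one_mul]
  have hroot : (AdjoinRoot.root ((X : Polynomial (Polynomial F)) ^ 2 - C α)) ^ 2
      = AdjoinRoot.of _ α := by
    have h := AdjoinRoot.eval₂_root ((X : Polynomial (Polynomial F)) ^ 2 - C α)
    rw [eval₂_sub, eval₂_pow, eval₂_X, eval₂_C, sub_eq_zero] at h
    exact h
  have h1 : (1 : Polynomial F) ∈ Ideal.span {a, b, c} := by rw [hprim]; trivial
  obtain ⟨x, y, z, hxyz⟩ := Submodule.mem_span_triple.1 h1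
  simp only [smul_eq_mul] at hxyz
  rw [hb] at hxyz
  generalize half F b = β at *
  have e1 := congrArg (AdjoinRoot.of ((X : Polynomial (Polynomial F)) ^ 2 - C α)) hxyz
  have e2 := congrArg (AdjoinRoot.of ((X : Polynomial (Polynomial F)) ^ 2 - C α)) habc
  simp only [map_add, map_mul, map_sub, map_pow, map_one] at e1 e2
  rw [← hroot] at e2
  generalize AdjoinRoot.root ((X : Polynomial (Polynomial F)) ^ 2 - C α) = r at *
  generalize AdjoinRoot.of ((X : Polynomial (Polynomial F)) ^ 2 - C α) = f at *
  rw [Ideal.span_pair_mul_span_pair]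
  apply le_antisymm
  · rw [Ideal.span_le]
    intro t ht
    simp only [Set.mem_insert_iff, Set.mem_singleton_iff] at ht
    rw [SetLike.mem_coe, Ideal.mem_span_singleton]
    rcases ht with rfl | rfl | rfl | rfl
    · exact dvd_mul_right _ _
    · exact dvd_mul_right _ _
    · exact dvd_mul_left _ _
    · exact ⟨f c, by linear_combination e2⟩
  · rw [Ideal.span_singleton_le_iff_mem]
    have key : f a = f x * (f a * f a) + f y * (f a * (f β + r)) + f y * ((f β - r) * f a)
        + f z * ((f β - r) * (f β + r)) := by
      linear_combination (-f a) * e1 - f z * e2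
    generalize hI : Ideal.span (_ : Set (OK F α)) = I
    rw [key, ← hI]
    refine add_mem (add_mem (add_mem ?_ ?_) ?_) ?_ <;>
      exact Ideal.mul_mem_left _ _ (Ideal.subset_span (by simp))

end
end

section
/- Let q be an odd prime power, α ∈ 𝔽_q[X] squarefree and nonconstant, and O_K = 𝔽_q[X][√α] = AdjoinRoot(Y² − α) (a Dedekind domain). Let a, b, c ∈ 𝔽_q[X] with a ≠ 0, (b/2)² − α = a·c, and the ideal generated by a, b, c equal to the unit ideal. Then the classes of the nonzero ideals (a, b/2 − √α) and (a, b/2 + √α) in ClassGroup(O_K) are mutually inverse; that is, the ideal class attached to the opposite form (a, −b, c) is the inverse of the ideal class attached to (a, b, c). -/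
open Polynomial Matrix
open scoped nonZeroDivisors

noncomputable section

theorem span_mul_span_opposite {R : Type} [CommRing R] (A H r C x y z : R)
    (h : H ^ 2 - r ^ 2 = A * C) (h1 : x * A + y * (2 * H) + z * C = 1) :
    Ideal.span {A, H - r} * Ideal.span {A, H + r} = Ideal.span {A} := by
  rw [Ideal.span_pair_mul_span_pair]
  apply le_antisymm
  · rw [Ideal.span_le]
    rintro t (rfl | rfl | rfl | rfl)
    · exact Ideal.mem_span_singleton.2 ⟨A, rfl⟩
    · exact Ideal.mem_span_singleton.2 ⟨H + r, rfl⟩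
    · exact Ideal.mem_span_singleton.2 ⟨H - r, by ring⟩
    · exact Ideal.mem_span_singleton.2 ⟨C, by rw [← h]; ring⟩
  · rw [Ideal.span_singleton_le_iff_mem]
    have e : A = x * (A * A) + y * (A * (H + r)) + y * ((H - r) * A)
        + z * ((H - r) * (H + r)) := by
      linear_combination (-A) * h1 - z * h
    rw [e]
    refine add_mem (add_mem (add_mem ?_ ?_) ?_) ?_ <;>
      exact Ideal.mul_mem_left _ _ (Ideal.subset_span (by simp [← e]))

/-- **Opposite forms give inverse ideal classes** (Remark `opposite`):
for `α` squarefree nonconstant, `a ≠ 0`, `(b/2)² - α = a·c` and `(a, b, c)` primitive, the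
classes of the nonzero ideals `(a, b/2 - √α)` and `(a, b/2 + √α)` in `ClassGroup(O_K)`
are mutually inverse. -/
theorem opposite_form_gives_inverse_class (F : Type) [Field F] [Fintype F]
    (hodd : Odd (Fintype.card F)) (α : Polynomial F) (hsf : Squarefree α)
    (hdeg : 0 < α.natDegree) [IsDedekindDomain (OK F α)]
    (a b c : Polynomial F) (ha : a ≠ 0) (habc : (half F b) ^ 2 - α = a * c)
    (hprim : Ideal.span {a, b, c} = (⊤ : Ideal (Polynomial F))) :
    ∃ (hI : Ideal.span {AdjoinRoot.of _ a, AdjoinRoot.of _ (half F b) - AdjoinRoot.root _} ∈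
        (Ideal (OK F α))⁰)
      (hJ : Ideal.span {AdjoinRoot.of _ a, AdjoinRoot.of _ (half F b) + AdjoinRoot.root _} ∈
        (Ideal (OK F α))⁰),
      ClassGroup.mk0 ⟨_, hI⟩ = (ClassGroup.mk0 ⟨_, hJ⟩)⁻¹ := by
  have h2 : (2 : F) ≠ 0 := by
    intro h
    have := (FiniteField.even_card_iff_char_two (F := F)).1
      ((CharP.ringChar_of_prime_eq_zero Nat.prime_two (by exact_mod_cast h)))
    rcases hodd with ⟨k, hk⟩
    omega
  have hb : b = 2 * half F b := by
    have : (2 : Polynomial F) = C 2 := (map_ofNat C 2).symm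
    rw [half, ← mul_assoc, this, ← C_mul, mul_inv_cancel₀ h2, C_1, one_mul]
  have hinj : Function.Injective
      (AdjoinRoot.of ((X : Polynomial (Polynomial F)) ^ 2 - C α)) := by
    apply AdjoinRoot.of.injective_of_degree_ne_zero
    rw [degree_X_pow_sub_C (by norm_num)]
    norm_num
  set φ := AdjoinRoot.of ((X : Polynomial (Polynomial F)) ^ 2 - C α) with hφ
  set r := AdjoinRoot.root ((X : Polynomial (Polynomial F)) ^ 2 - C α) with hr
  have hA : φ a ≠ 0 := (map_ne_zero_iff _ hinj).2 ha
  have hr2 : r ^ 2 = φ α := by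
    have := AdjoinRoot.eval₂_root ((X : Polynomial (Polynomial F)) ^ 2 - C α)
    rw [eval₂_sub, eval₂_pow, eval₂_X, eval₂_C] at this
    exact sub_eq_zero.1 this
  have h1 : (1 : Polynomial F) ∈ Ideal.span {a, b, c} := by rw [hprim]; trivial
  obtain ⟨x, y, z, hxyz⟩ := Submodule.mem_span_triple.1 h1
  have hrel : φ (half F b) ^ 2 - r ^ 2 = φ a * φ c := by
    rw [hr2, ← map_pow, ← map_sub, habc, map_mul]
  have hone : φ x * φ a + φ y * (2 * φ (half F b)) + φ z * φ c = 1 := by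
    have := congrArg φ hxyz
    rw [hb] at this
    simp only [smul_eq_mul, map_add, map_mul, map_one] at this
    rwa [show φ 2 = 2 from map_ofNat φ 2] at this
  have key := span_mul_span_opposite (φ a) (φ (half F b)) r (φ c) _ _ _ hrel hone
  have hne : ∀ t, Ideal.span {φ a, t} ∈ (Ideal (OK F α))⁰ := by
    intro t
    rw [mem_nonZeroDivisors_iff_ne_zero]
    intro h
    have : φ a ∈ Ideal.span {φ a, t} := Ideal.subset_span (by simp)
    rw [h] at this
    exact hA (by simpa using this)
  refine ⟨hne _, hne _, ?_⟩
  rw [eq_inv_iff_mul_eq_one, ← map_mul, Submonoid.mk_mul_mk, ClassGroup.mk0_eq_one_iff, key]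
  exact ⟨⟨φ a, rfl⟩⟩

end
end

section
/- Let q be an odd prime power and α ∈ 𝔽_q[X] squarefree and nonconstant such that K = 𝔽_q(X)(√α) is imaginary (deg α odd, or deg α even with non-square leading coefficient). Then every unit of O_K = 𝔽_q[X][√α] = AdjoinRoot(Y² − α) is the image of a nonzero constant, i.e., (O_K)^× equals the image of 𝔽_q^× under the structure map. Consequently, the image of the norm map Nr : (O_K)^× → 𝔽_q[X]^× = 𝔽_q^× (with Nr(u + v√α) = u² − αv²) is exactly the subgroup (𝔽_q^×)² of squares, and the quotient 𝔽_q^× / Nr((O_K)^×) has order 2. -/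
open Polynomial Matrix
open scoped nonZeroDivisors

noncomputable section

theorem OK_monic (F : Type) [Field F] (α : Polynomial F) :
    ((X : Polynomial (Polynomial F)) ^ 2 - C α).Monic :=
  monic_X_pow_sub_C α two_ne_zero

theorem OK_exists_rep (F : Type) [Field F] (α : Polynomial F) (x : OK F α) :
    ∃ a b : Polynomial F, x = AdjoinRoot.mk _ (C b * X + C a) := by
  obtain ⟨p, rfl⟩ := AdjoinRoot.mk_surjective x
  have h1 : (p %ₘ ((X : Polynomial (Polynomial F)) ^ 2 - C α)).natDegree ≤ 1 := by
    have := natDegree_modByMonic_lt p (OK_monic F α) (by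
      intro h
      have := congrArg natDegree h
      rw [natDegree_X_pow_sub_C] at this
      simp at this)
    rw [natDegree_X_pow_sub_C] at this
    omega
  obtain ⟨b, a, h⟩ := exists_eq_X_add_C_of_natDegree_le_one h1
  refine ⟨a, b, ?_⟩
  rw [← h, AdjoinRoot.mk_eq_mk, modByMonic_eq_sub_mul_div]
  simp

theorem OK_rep_zero (F : Type) [Field F] (α a b : Polynomial F)
    (h : (AdjoinRoot.mk _ (C b * X + C a) : OK F α) = 0) : a = 0 ∧ b = 0 := by
  rw [AdjoinRoot.mk_eq_zero] at h
  have h0 : (C b * X + C a : Polynomial (Polynomial F)) = 0 := by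
    by_contra hne
    refine (OK_monic F α).not_dvd_of_natDegree_lt hne ?_ h
    rw [natDegree_X_pow_sub_C]
    exact lt_of_le_of_lt natDegree_linear_le one_lt_two
  constructor
  · simpa using congrArg (fun p => coeff p 0) h0
  · simpa using congrArg (fun p => coeff p 1) h0

theorem imaginary_norm_unit (F : Type) [Field F] (α : Polynomial F)
    (hdeg : 0 < α.natDegree) (him : Imaginary F α) (a b : Polynomial F)
    (h : IsUnit (a ^ 2 - α * b ^ 2)) : b = 0 := by
  by_contra hb
  have hα : α ≠ 0 := by rintro rfl; simp at hdeg
  have h0 : (a ^ 2 - α * b ^ 2).natDegree = 0 := natDegree_eq_zero_of_isUnit h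
  have hd : (α * b ^ 2).natDegree = α.natDegree + 2 * b.natDegree := by
    rw [natDegree_mul hα (pow_ne_zero 2 hb), natDegree_pow]
  have hd2 : (a ^ 2).natDegree = 2 * a.natDegree := natDegree_pow a 2
  have e1 : (a ^ 2).natDegree = (α * b ^ 2).natDegree := by
    by_contra hne
    rcases lt_or_gt_of_ne hne with hlt | hlt
    · rw [natDegree_sub_eq_right_of_natDegree_lt hlt] at h0
      omega
    · rw [natDegree_sub_eq_left_of_natDegree_lt hlt] at h0
      omega
  have hc : (a ^ 2 - α * b ^ 2).coeff (α * b ^ 2).natDegree = 0 :=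
    coeff_eq_zero_of_natDegree_lt (by omega)
  rw [coeff_sub, coeff_natDegree, ← e1, coeff_natDegree, leadingCoeff_pow, leadingCoeff_mul,
    leadingCoeff_pow, sub_eq_zero] at hc
  rcases him with ho | ⟨_, hns⟩
  · obtain ⟨k, hk⟩ := ho
    omega
  · apply hns
    have hlb : b.leadingCoeff ≠ 0 := leadingCoeff_ne_zero.mpr hb
    refine ⟨a.leadingCoeff / b.leadingCoeff, ?_⟩
    field_simp
    exact hc.symm

theorem OK_unit_const (F : Type) [Field F] (α : Polynomial F)
    (hdeg : 0 < α.natDegree) (him : Imaginary F α) (u : (OK F α)ˣ) : ∃ c : Fˣ,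
      (u : OK F α) = algebraMap (Polynomial F) (OK F α) (C (c : F)) := by
  obtain ⟨a, b, hu⟩ := OK_exists_rep F α u
  obtain ⟨c, d, hv⟩ := OK_exists_rep F α (u⁻¹ : (OK F α)ˣ)
  have huv : (u : OK F α) * (u⁻¹ : (OK F α)ˣ) = 1 := u.mul_inv
  have hz : (AdjoinRoot.mk _ (C (a * d + b * c) * X + C (a * c + α * b * d - 1)) : OK F α) = 0 := by
    rw [hu, hv, ← map_mul, ← sub_eq_zero, ← map_one (AdjoinRoot.mk _), ← map_sub,
      AdjoinRoot.mk_eq_zero] at huv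
    rw [AdjoinRoot.mk_eq_zero]
    have := dvd_sub huv (Dvd.intro_left (C (b * d)) rfl)
    convert this using 1
    simp only [C_add, C_mul, C_sub, C_1]
    ring
  obtain ⟨h1, h2⟩ := OK_rep_zero F α _ _ hz
  have hN : (a ^ 2 - α * b ^ 2) * (c ^ 2 - α * d ^ 2) = 1 := by
    linear_combination (a * c + α * b * d + 1) * h1 - α * (a * d + b * c) * h2
  have hb := imaginary_norm_unit F α hdeg him a b (IsUnit.of_mul_eq_one _ hN)
  subst hb
  have ha : IsUnit a := IsUnit.of_mul_eq_one c (by linear_combination h1)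
  obtain ⟨r, hr, hra⟩ := Polynomial.isUnit_iff.mp ha
  refine ⟨hr.unit, ?_⟩
  rw [hu, ← hra]
  simp [AdjoinRoot.algebraMap_eq]

theorem OK_norm_const (F : Type) [Field F] (α p : Polynomial F) :
    Algebra.norm (Polynomial F) (algebraMap (Polynomial F) (OK F α) p) = p ^ 2 := by
  rw [Algebra.norm_algebraMap_of_basis (AdjoinRoot.powerBasis' (OK_monic F α)).basis,
    Fintype.card_fin, AdjoinRoot.powerBasis'_dim, natDegree_X_pow_sub_C]

/-- **Units and norms of the imaginary quadratic ring `O_K`** (Lemma `reduced definite`):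
if `K = 𝔽_q(X)(√α)` is imaginary then every unit of `O_K = 𝔽_q[X][√α]` comes from `𝔽_q^×`,
the image of the norm `Nr : O_K^× → 𝔽_q^×` is exactly `(𝔽_q^×)²`, and the quotient
`𝔽_q^×/Nr(O_K^×)` has order 2. -/
theorem units_and_norms_of_imaginary_OK (F : Type) [Field F] [Fintype F]
    (hodd : Odd (Fintype.card F)) (α : Polynomial F) (hsf : Squarefree α)
    (hdeg : 0 < α.natDegree) (him : Imaginary F α) :
    (∀ u : (OK F α)ˣ, ∃ c : Fˣ,
        (u : OK F α) = algebraMap (Polynomial F) (OK F α) (Polynomial.C (c : F))) ∧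
    (∀ c : Fˣ, IsUnit (algebraMap (Polynomial F) (OK F α) (Polynomial.C (c : F)))) ∧
    (∀ w : Polynomial F,
        (∃ u : (OK F α)ˣ, Algebra.norm (Polynomial F) (u : OK F α) = w) ↔
          ∃ t : Fˣ, w = Polynomial.C ((t : F) ^ 2)) ∧
    ∃ H : Subgroup Fˣ,
      (∀ t : Fˣ, t ∈ H ↔
        ∃ u : (OK F α)ˣ, Algebra.norm (Polynomial F) (u : OK F α) = Polynomial.C (t : F)) ∧
      H.index = 2 := by
  have hA := OK_unit_const F α hdeg him
  have hB : ∀ c : Fˣ, IsUnit (algebraMap (Polynomial F) (OK F α) (Polynomial.C (c : F))) :=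
    fun c => ((c.isUnit.map (C : F →+* Polynomial F)).map (algebraMap (Polynomial F) (OK F α)))
  have hC : ∀ w : Polynomial F,
      (∃ u : (OK F α)ˣ, Algebra.norm (Polynomial F) (u : OK F α) = w) ↔
        ∃ t : Fˣ, w = Polynomial.C ((t : F) ^ 2) := by
    intro w
    constructor
    · rintro ⟨u, rfl⟩
      obtain ⟨c, hc⟩ := hA u
      exact ⟨c, by rw [hc, OK_norm_const, C_pow]⟩
    · rintro ⟨t, rfl⟩
      exact ⟨(hB t).unit, by rw [IsUnit.unit_spec, OK_norm_const, C_pow]⟩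
  refine ⟨hA, hB, hC, (powMonoidHom 2 : Fˣ →* Fˣ).range, ?_, ?_⟩
  · intro t
    rw [hC]
    constructor
    · rintro ⟨s, rfl⟩
      exact ⟨s, by simp⟩
    · rintro ⟨s, hs⟩
      exact ⟨s, Units.ext (by simpa using (C_injective hs).symm)⟩
  · rw [IsCyclic.index_powMonoidHom_range, Nat.gcd_eq_right_iff_dvd, Nat.card_units,
      Nat.card_eq_fintype_card]
    obtain ⟨k, hk⟩ := hodd
    exact ⟨k, by omega⟩
end
end

section
/- Let q be an odd prime power and α ∈ 𝔽_q[X] a nonzero polynomial. Then the image of α under the 𝔽_q-algebra homomorphism 𝔽_q[X] → 𝔽_q((t)) sending X to t⁻¹ is a square in the Laurent series field 𝔽_q((t)) if and only if the degree of α is even and the leading coefficient of α is a square in 𝔽_q. (This is the criterion deciding whether the place at infinity of 𝔽_q(X) splits in 𝔽_q(X)(√α); when deg α is odd the place at infinity ramifies, and when deg α is even with non-square leading coefficient it is inert.) -/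
lemma aux_sq (F : Type) [Field F] (h2 : (2 : F) ≠ 0) (P : PowerSeries F)
    (h0 : PowerSeries.constantCoeff P ≠ 0) (hs : IsSquare (PowerSeries.constantCoeff P)) :
    IsSquare P := by
  obtain ⟨c, hc⟩ := hs
  have hc0 : c ≠ 0 := by rintro rfl; simp at hc; exact h0 hc
  obtain ⟨a, ha, -⟩ := HenselianRing.is_henselian (I := (Ideal.span {PowerSeries.X} : Ideal (PowerSeries F)))
    (Polynomial.X ^ 2 - Polynomial.C P) (Polynomial.monic_X_pow_sub_C _ (by norm_num))
    (PowerSeries.C c) (by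
      rw [Ideal.mem_span_singleton, PowerSeries.X_dvd_iff]
      simp [hc, sq]) (by
      apply IsUnit.map
      rw [PowerSeries.isUnit_iff_constantCoeff]
      have h3 : PowerSeries.constantCoeff (2 : PowerSeries F) = 2 := map_ofNat _ 2
      simp [hc0, one_add_one_eq_two, h2, h3])
  refine ⟨a, ?_⟩
  simp [sub_eq_zero] at ha
  rw [← ha, sq]

lemma aux_order (F : Type) [Field F] (P : PowerSeries F)
    (h0 : PowerSeries.constantCoeff P ≠ 0) :
    (P : LaurentSeries F).order = 0 := by
  have hc : (P : LaurentSeries F).coeff 0 ≠ 0 := by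
    simpa using (LaurentSeries.coeff_coe_powerSeries P 0).trans_ne (by simpa using h0)
  have hne : (P : LaurentSeries F) ≠ 0 := by
    intro h; rw [h] at hc; simp at hc
  apply le_antisymm (HahnSeries.order_le_of_coeff_ne_zero hc)
  by_contra hlt
  apply HahnSeries.leadingCoeff_ne_zero.mpr hne
  rw [HahnSeries.leadingCoeff_eq]
  rw [PowerSeries.coeff_coe, if_pos (by omega)]

lemma aux_key (F : Type) [Field F] (α : Polynomial F) :
    (Polynomial.aeval (((PowerSeries.X : PowerSeries F) : LaurentSeries F)⁻¹) α) *
      ((PowerSeries.X : PowerSeries F) : LaurentSeries F) ^ α.natDegree =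
    ((α.reverse : PowerSeries F) : LaurentSeries F) := by
  have hX : ((PowerSeries.X : PowerSeries F) : LaurentSeries F) ≠ 0 := by
    simp
  letI : Invertible (((PowerSeries.X : PowerSeries F) : LaurentSeries F)⁻¹) :=
    ⟨_, mul_inv_cancel₀ hX, inv_mul_cancel₀ hX⟩
  have h := Polynomial.eval₂_reverse_mul_pow (algebraMap F (LaurentSeries F))
    (((PowerSeries.X : PowerSeries F) : LaurentSeries F)⁻¹) α
  rw [Polynomial.aeval_def, ← h, mul_assoc, ← mul_pow, inv_mul_cancel₀ hX, one_pow, mul_one]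
  change Polynomial.eval₂ _ ((PowerSeries.X : PowerSeries F) : LaurentSeries F) _ = _
  generalize α.reverse = β
  induction β using Polynomial.induction_on' with
  | add p q hp hq => rw [Polynomial.eval₂_add, hp, hq]; simp
  | monomial n a =>
    rw [← Polynomial.C_mul_X_pow_eq_monomial, Polynomial.eval₂_mul]
    simp [LaurentSeries.algebraMap_apply]

/-- **Behaviour at infinity** (Remark `ramified inert split`): for a nonzero polynomial
`α ∈ 𝔽_q[X]`, its image under `X ↦ t⁻¹` is a square in the Laurent series field `𝔽_q((t))`
(the completion at infinity) iff `deg α` is even and the leading coefficient of `α` is a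
square in `𝔽_q`. -/
theorem square_at_infinity_iff (F : Type) [Field F] [Fintype F]
    (hodd : Odd (Fintype.card F)) (α : Polynomial F) (hα : α ≠ 0) :
    IsSquare (Polynomial.aeval
        (((PowerSeries.X : PowerSeries F) : LaurentSeries F)⁻¹) α) ↔
      (Even α.natDegree ∧ IsSquare α.leadingCoeff) := by
  have h2 : (2 : F) ≠ 0 := by
    apply Ring.two_ne_zero
    intro h
    have := FiniteField.even_card_of_char_two h
    obtain ⟨k, hk⟩ := hodd
    omega
  have hX : ((PowerSeries.X : PowerSeries F) : LaurentSeries F) ≠ 0 := by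
    simp
  have key := aux_key F α
  have hcc : PowerSeries.constantCoeff (α.reverse : PowerSeries F) = α.leadingCoeff := by
    simp
  have hl0 : PowerSeries.constantCoeff (α.reverse : PowerSeries F) ≠ 0 := by
    rw [hcc]; simpa using hα
  have hord := aux_order F _ hl0
  constructor
  · rintro ⟨y, hy⟩
    rw [hy] at key
    have hy0 : y ≠ 0 := by
      rintro rfl
      have h3 : ((α.reverse : PowerSeries F) : LaurentSeries F).coeff (0 : ℕ) = 0 := by
        rw [← key]; simp
      rw [LaurentSeries.coeff_coe_powerSeries] at h3
      exact hl0 (by simpa using h3)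
    have hev : Even α.natDegree := by
      rw [← key, HahnSeries.order_mul (mul_ne_zero hy0 hy0) (pow_ne_zero _ hX),
        HahnSeries.order_mul hy0 hy0, HahnSeries.order_pow, PowerSeries.coe_X,
        HahnSeries.order_single one_ne_zero] at hord
      simp at hord
      rw [Nat.even_iff]
      omega
    refine ⟨hev, y.leadingCoeff, ?_⟩
    obtain ⟨m, hm⟩ := hev
    have hz : (y * ((PowerSeries.X : PowerSeries F) : LaurentSeries F) ^ m).leadingCoeff
        = y.leadingCoeff := by
      rw [HahnSeries.leadingCoeff_mul, PowerSeries.coe_X, HahnSeries.single_pow]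
      simp
    have h4 := congrArg HahnSeries.leadingCoeff key
    rw [hm, pow_add, mul_mul_mul_comm, HahnSeries.leadingCoeff_mul, hz,
      HahnSeries.leadingCoeff_eq (x := ((α.reverse : PowerSeries F) : LaurentSeries F)), hord] at h4
    have h5 := LaurentSeries.coeff_coe_powerSeries (α.reverse : PowerSeries F) 0
    rw [h4]
    simpa using h5.symm
  · rintro ⟨⟨m, hm⟩, hs⟩
    obtain ⟨Q, hQ⟩ := aux_sq F h2 (α.reverse : PowerSeries F) hl0 (hcc ▸ hs)
    refine ⟨(Q : LaurentSeries F) / ((PowerSeries.X : PowerSeries F) : LaurentSeries F) ^ m, ?_⟩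
    rw [hQ, PowerSeries.coe_mul] at key
    rw [div_mul_div_comm, ← pow_add, ← hm, ← key, mul_div_cancel_right₀ _ (pow_ne_zero _ hX)]
end

section
/- Let q be an odd prime power and α ∈ 𝔽_q[X] separable and nonconstant with K = 𝔽_q(X)(√α) imaginary, and let O_K = 𝔽_q[X][√α]. Then every element of ClassGroup(O_K) is the class of an integral ideal of the form (a, b/2 − √α) = Ideal.span {a, b/2 − √α} for some a, b ∈ 𝔽_q[X] with a ≠ 0 and a dividing (b/2)² − α. -/
open Polynomial Matrix
open scoped nonZeroDivisors

noncomputable section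

section Helpers

variable (F : Type) [Field F] (α : Polynomial F)

theorem aux_monic : ((X : Polynomial (Polynomial F)) ^ 2 - C α).Monic :=
  monic_X_pow_sub_C α two_ne_zero

theorem aux_root_sq : (AdjoinRoot.root _ : OK F α) * AdjoinRoot.root _ = AdjoinRoot.of _ α := by
  have h := AdjoinRoot.eval₂_root ((X : Polynomial (Polynomial F)) ^ 2 - C α)
  simp only [eval₂_sub, eval₂_pow, eval₂_X, eval₂_C] at h
  rw [← sq]
  exact sub_eq_zero.mp h

theorem aux_repr (z : OK F α) : ∃ x y : Polynomial F,
    z = AdjoinRoot.of _ x + AdjoinRoot.of _ y * AdjoinRoot.root _ := by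
  induction z using AdjoinRoot.induction_on with
  | ih p =>
    induction p using Polynomial.induction_on' with
    | add p q hp hq =>
      obtain ⟨x, y, h⟩ := hp
      obtain ⟨x', y', h'⟩ := hq
      refine ⟨x + x', y + y', ?_⟩
      rw [map_add, h, h', map_add, map_add]
      ring
    | monomial n c =>
      induction n with
      | zero => exact ⟨c, 0, by simp⟩
      | succ n ih =>
        obtain ⟨x, y, h⟩ := ih
        refine ⟨y * α, x, ?_⟩
        rw [← monomial_mul_X, map_mul, h, AdjoinRoot.mk_X, map_mul, ← aux_root_sq]
        ring

theorem aux_uniq (x y : Polynomial F)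
    (h : (AdjoinRoot.of _ x + AdjoinRoot.of _ y * AdjoinRoot.root _ : OK F α) = 0) :
    x = 0 ∧ y = 0 := by
  have h1 : AdjoinRoot.mk ((X : Polynomial (Polynomial F)) ^ 2 - C α) (C y * X + C x) = 0 := by
    rw [map_add, map_mul, AdjoinRoot.mk_X, AdjoinRoot.mk_C, AdjoinRoot.mk_C, add_comm]
    exact h
  rw [AdjoinRoot.mk_eq_zero] at h1
  have h2 : C y * X + C x = 0 := by
    by_contra hne
    refine (aux_monic F α).not_dvd_of_degree_lt hne ?_ h1
    rw [degree_X_pow_sub_C (by norm_num) α]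
    exact lt_of_le_of_lt degree_linear_le (by norm_num)
  constructor
  · simpa using congrArg (fun p => coeff p 0) h2
  · simpa using congrArg (fun p => coeff p 1) h2

/-- The ideal of second coordinates. -/
def coordIdeal (I : Ideal (OK F α)) : Ideal (Polynomial F) where
  carrier := {y | ∃ x, (AdjoinRoot.of _ x + AdjoinRoot.of _ y * AdjoinRoot.root _ : OK F α) ∈ I}
  zero_mem' := ⟨0, by simp⟩
  add_mem' := by
    rintro y y' ⟨x, h⟩ ⟨x', h'⟩
    refine ⟨x + x', ?_⟩
    convert I.add_mem h h' using 1
    rw [map_add, map_add]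
    ring
  smul_mem' := by
    rintro c y ⟨x, h⟩
    refine ⟨c * x, ?_⟩
    convert I.mul_mem_left (AdjoinRoot.of _ c) h using 1
    rw [smul_eq_mul, map_mul, map_mul]
    ring

theorem aux_ideal [IsDomain (OK F α)] (I : Ideal (OK F α)) (hI : I ≠ ⊥) :
    ∃ d a h : Polynomial F, d ≠ 0 ∧ a ≠ 0 ∧ a ∣ h ^ 2 - α ∧
      I = Ideal.span {AdjoinRoot.of _ d} *
        Ideal.span {AdjoinRoot.of _ a, AdjoinRoot.of _ h - AdjoinRoot.root _} := by
  obtain ⟨m, hm⟩ := (IsPrincipalIdealRing.principal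
    (I.comap (AdjoinRoot.of ((X : Polynomial (Polynomial F)) ^ 2 - C α)))).principal
  obtain ⟨d, hd⟩ := (IsPrincipalIdealRing.principal (coordIdeal F α I)).principal
  have hm' : ∀ t, (AdjoinRoot.of _ t : OK F α) ∈ I ↔ m ∣ t := fun t => by
    rw [← Ideal.mem_span_singleton, ← Ideal.submodule_span_eq, ← hm, Ideal.mem_comap]
  have hd' : ∀ y, (∃ x, (AdjoinRoot.of _ x + AdjoinRoot.of _ y * AdjoinRoot.root _ : OK F α) ∈ I)
      ↔ d ∣ y := fun y => by
    rw [← Ideal.mem_span_singleton, ← Ideal.submodule_span_eq, ← hd]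
    rfl
  have hr := aux_root_sq F α
  have hm0 : m ≠ 0 := by
    obtain ⟨z, hz, hz0⟩ := Submodule.exists_mem_ne_zero_of_ne_bot hI
    obtain ⟨x, y, rfl⟩ := aux_repr F α z
    have h1 : (AdjoinRoot.of _ (x ^ 2 - α * y ^ 2) : OK F α) =
        (AdjoinRoot.of _ x + AdjoinRoot.of _ (-y) * AdjoinRoot.root _) *
        (AdjoinRoot.of _ x + AdjoinRoot.of _ y * AdjoinRoot.root _) := by
      simp only [map_sub, map_mul, map_pow, map_neg]
      rw [← hr]
      ring
    have h2 : m ∣ x ^ 2 - α * y ^ 2 := (hm' _).1 (h1 ▸ I.mul_mem_left _ hz)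
    rintro rfl
    rw [zero_dvd_iff] at h2
    rw [h2, map_zero] at h1
    rcases mul_eq_zero.1 h1.symm with h3 | h3
    · obtain ⟨hx, hy⟩ := aux_uniq F α _ _ h3
      apply hz0
      rw [neg_eq_zero] at hy
      simp [hx, hy]
    · exact hz0 h3
  obtain ⟨a, rfl⟩ : d ∣ m := (hd' m).1 ⟨0, by
    rw [map_zero, zero_add]
    exact I.mul_mem_right _ ((hm' m).2 dvd_rfl)⟩
  obtain ⟨e, he⟩ := (hd' d).2 dvd_rfl
  obtain ⟨g, rfl⟩ : d ∣ e := (hd' e).1 ⟨d * α, by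
    convert I.mul_mem_right (AdjoinRoot.root _) he using 1
    rw [map_mul, ← hr]
    ring⟩
  have hd0 : d ≠ 0 := left_ne_zero_of_mul hm0
  refine ⟨d, a, -g, hd0, right_ne_zero_of_mul hm0, ?_, ?_⟩
  · rw [← mul_dvd_mul_iff_left hd0, ← hm']
    convert I.mul_mem_right (AdjoinRoot.of _ g - AdjoinRoot.root _) he using 1
    simp only [map_sub, map_mul, map_pow, map_neg]
    rw [← hr]
    ring
  · rw [Ideal.span_mul_span']
    simp only [Set.singleton_mul, Set.image_insert_eq, Set.image_singleton]
    apply le_antisymm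
    · intro z hz
      obtain ⟨x, y, rfl⟩ := aux_repr F α z
      obtain ⟨k, rfl⟩ := (hd' y).1 ⟨x, hz⟩
      have h1 : (AdjoinRoot.of _ (x - d * g * k) : OK F α) ∈ I := by
        convert I.sub_mem hz (I.mul_mem_left (AdjoinRoot.of _ k) he) using 1
        simp only [map_sub, map_mul]
        ring
      obtain ⟨l, hl⟩ := (hm' _).1 h1
      rw [Ideal.mem_span_pair]
      refine ⟨AdjoinRoot.of _ l, - AdjoinRoot.of _ k, ?_⟩
      rw [sub_eq_iff_eq_add.1 hl]
      simp only [map_add, map_mul, map_neg]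
      ring
    · rw [Ideal.span_le]
      rintro z (rfl | rfl)
      · rw [← map_mul]
        exact (hm' _).2 dvd_rfl
      · show _ ∈ I
        convert I.neg_mem he using 1
        simp only [map_mul, map_neg]
        ring

end Helpers

/-- **Every ideal class comes from a form** (surjectivity in Theorem `Gauss`):
for `α` separable nonconstant with `K = 𝔽_q(X)(√α)` imaginary, every element of
`ClassGroup(O_K)` is the class of an ideal `(a, b/2 - √α)` with `a ≠ 0` and
`a ∣ (b/2)² - α`. -/
theorem classgroup_represented_by_forms (F : Type) [Field F] [Fintype F]
    (hodd : Odd (Fintype.card F)) (α : Polynomial F) (hsep : α.Separable)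
    (hdeg : 0 < α.natDegree) (him : Imaginary F α) [IsDedekindDomain (OK F α)] :
    ∀ C : ClassGroup (OK F α),
      ∃ (a b : Polynomial F) (_ : a ≠ 0) (_ : a ∣ (half F b) ^ 2 - α)
        (J : (Ideal (OK F α))⁰),
        (J : Ideal (OK F α)) = idealOf F α a b ∧ ClassGroup.mk0 J = C := by
  intro C
  obtain ⟨I, rfl⟩ := ClassGroup.mk0_surjective C
  have hI : (I : Ideal (OK F α)) ≠ ⊥ := nonZeroDivisors.coe_ne_zero I
  obtain ⟨d, a, g, hd, ha, hdvd, hI'⟩ := aux_ideal F α I hI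
  have h2 : (2 : F) ≠ 0 := by
    intro h
    have := ringChar.dvd (R := F) (x := 2) (by exact_mod_cast h)
    have hc : ringChar F = 2 := by
      rcases (Nat.dvd_prime Nat.prime_two).1 this with h | h
      · exact absurd h (CharP.ringChar_ne_one)
      · exact h
    have h3 := FiniteField.even_card_iff_char_two.1 hc
    rcases hodd with ⟨k, hk⟩
    omega
  have hh : half F (Polynomial.C 2 * g) = g := by
    rw [half, ← mul_assoc, ← Polynomial.C_mul, inv_mul_cancel₀ h2, Polynomial.C_1, one_mul]
  have hJ : idealOf F α a (Polynomial.C 2 * g) ≠ ⊥ := by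
    intro h
    rw [idealOf, hh] at h
    rw [h, Ideal.mul_bot] at hI'
    exact hI hI'
  refine ⟨a, Polynomial.C 2 * g, ha, by rwa [hh],
    ⟨idealOf F α a (Polynomial.C 2 * g), mem_nonZeroDivisors_of_ne_zero hJ⟩, rfl, ?_⟩
  rw [ClassGroup.mk0_eq_mk0_iff]
  refine ⟨AdjoinRoot.of _ d, 1, ?_, one_ne_zero, ?_⟩
  · intro h
    exact hd (aux_uniq F α d 0 (by rw [h]; simp)).1
  · rw [Ideal.span_singleton_one, Ideal.one_eq_top.symm, one_mul, hI']
    simp only [idealOf, hh]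

end
end

section
/- Let q be an odd prime power and α ∈ 𝔽_q[X] squarefree and nonzero. Then the set of proper-isomorphism classes of binary quadratic forms (a,b,c) over 𝔽_q[X] with b² − 4ac = 4α is finite. -/
open Polynomial Matrix
open scoped nonZeroDivisors

noncomputable section

lemma quot_shift (F : Type) [Field F] (h2 : (2 : F) ≠ 0) (a b c t : Polynomial F) :
    ProperEquiv F (a, b, c) (a, b + 2 * a * t, c + b * t + a * t ^ 2) := by
  have hC : (C (2⁻¹ : F)) * 2 = 1 := by
    rw [show (2 : F[X]) = C 2 from rfl, ← C_mul, inv_mul_cancel₀ h2, C_1]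
  refine ⟨!![1, t; 0, 1], ⟨1, by simp [Matrix.det_fin_two]⟩, ?_⟩
  ext1 i j
  fin_cases i <;> fin_cases j <;>
    simp [_root_.gram, half, Matrix.mul_apply, Fin.sum_univ_two]
  · linear_combination (-a * t) * hC
  · linear_combination (-a * t) * hC
  · linear_combination (b * t) * hC

lemma quot_swap (F : Type) [Field F] (a b c : Polynomial F) :
    ProperEquiv F (a, b, c) (c, -b, a) := by
  refine ⟨!![0, -1; 1, 0], ⟨1, by simp [Matrix.det_fin_two]⟩, ?_⟩
  ext1 i j
  fin_cases i <;> fin_cases j <;>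
    simp [_root_.gram, half, Matrix.mul_apply, Fin.sum_univ_two]

lemma finite_bounded (F : Type) [Field F] [Fintype F] (n : ℕ) :
    Set.Finite {p : Polynomial F | p.degree ≤ n} := by
  have : Finite (Polynomial.degreeLT F (n + 1)) :=
    Finite.of_equiv _ (Polynomial.degreeLTEquiv F (n + 1)).toEquiv.symm
  refine (Set.toFinite (Polynomial.degreeLT F (n + 1) : Set F[X])).subset ?_
  intro p hp
  simp only [SetLike.mem_coe, Polynomial.mem_degreeLT]
  refine lt_of_le_of_lt hp ?_
  exact_mod_cast Nat.lt_succ_self n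

/-- **Finiteness of the class set** (finiteness of `cl₁(disc)`): for `α` squarefree nonzero,
there are only finitely many proper-isomorphism classes of binary quadratic forms over
`𝔽_q[X]` of discriminant `b² - 4ac = 4α`. -/
theorem finitely_many_proper_classes (F : Type) [Field F] [Fintype F]
    (hodd : Odd (Fintype.card F)) (α : Polynomial F) (hsf : Squarefree α) (hα : α ≠ 0) :
    Finite (Quot (fun f g : {f : Polynomial F × Polynomial F × Polynomial F //
        f.2.1 ^ 2 - 4 * (f.1 * f.2.2) = 4 * α} =>
      ProperEquiv F f.1 g.1)) := by
  have h2 : (2 : F) ≠ 0 := by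
    intro h
    have hc : ringChar F = 2 := by
      apply CharP.ringChar_of_prime_eq_zero Nat.prime_two
      exact_mod_cast h
    have := (FiniteField.even_card_iff_char_two (F := F)).1 hc
    rw [Nat.odd_iff] at hodd
    omega
  have hC : (C (2⁻¹ : F)) * 2 = 1 := by
    rw [show (2 : F[X]) = C 2 from rfl, ← C_mul, inv_mul_cancel₀ h2, C_1]
  have h4 : (4 : F) ≠ 0 := by
    rw [show (4 : F) = 2 * 2 by norm_num]
    exact mul_ne_zero h2 h2
  have hdeg4 : ∀ p : F[X], (4 * p).degree = p.degree := fun p => by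
    rw [show (4 : F[X]) = C 4 from rfl, degree_C_mul h4]
  set n := α.natDegree with hn
  have hαn : α.degree = n := degree_eq_natDegree hα
  let D : Set (F[X] × F[X] × F[X]) := {f | f.2.1 ^ 2 - 4 * (f.1 * f.2.2) = 4 * α}
  let T : Set D := {f | f.1.1.degree ≤ n ∧ f.1.2.1.degree ≤ n ∧ f.1.2.2.degree ≤ n}
  have hT : T.Finite := by
    have hP := (finite_bounded F n).prod ((finite_bounded F n).prod (finite_bounded F n))
    refine Set.Finite.of_finite_image (f := Subtype.val) (hP.subset ?_)
      Subtype.val_injective.injOn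
    rintro _ ⟨f, hf, rfl⟩
    exact ⟨hf.1, hf.2.1, hf.2.2⟩
  have := hT.to_subtype
  let r : D → D → Prop := fun f g => ProperEquiv F f.1 g.1
  change Finite (Quot r)
  refine Finite.of_surjective (fun f : T => Quot.mk r f.1) ?_
  intro x
  by_cases h0 : ∃ f : D, Quot.mk r f = x ∧ f.1.1 = 0
  · obtain ⟨⟨⟨a, b, c⟩, hf⟩, hx, ha⟩ := h0
    simp only at ha
    subst ha
    have hf' : b ^ 2 = 4 * α := by simpa [D] using hf
    have hb0 : b ≠ 0 := by
      rintro rfl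
      have := hdeg4 α
      rw [← hf', hαn] at this
      simp at this
    have hbd : b.degree ≤ n := by
      have := hdeg4 α
      rw [← hf', hαn, degree_pow, degree_eq_natDegree hb0] at this
      rw [degree_eq_natDegree hb0]
      have h' : 2 * b.natDegree = n := by
        rw [nsmul_eq_mul] at this
        exact_mod_cast this
      exact_mod_cast (by omega : b.natDegree ≤ n)
    have hs := quot_shift F h2 0 b c (-(c / b))
    have e : c + b * (-(c / b)) + 0 * (-(c / b)) ^ 2 = c % b := by
      rw [EuclideanDomain.mod_eq_sub_mul_div]; ring
    have e2 : b + 2 * 0 * (-(c / b)) = b := by ring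
    rw [e, e2] at hs
    have hg : (0, b, c % b) ∈ D := by simpa [D] using hf'
    refine ⟨⟨⟨_, hg⟩, ?_, hbd, ?_⟩, ?_⟩
    · simp
    · exact ((EuclideanDomain.mod_lt c hb0).le).trans hbd
    · rw [← hx]
      exact (Quot.sound (r := r) (a := ⟨_, hf⟩) (b := ⟨_, hg⟩) hs).symm
  · push Not at h0
    obtain ⟨f0, hf0⟩ := Quot.exists_rep x
    have hne : {k : ℕ | ∃ f : D, Quot.mk r f = x ∧ f.1.1.natDegree = k}.Nonempty :=
      ⟨_, f0, hf0, rfl⟩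
    obtain ⟨⟨⟨a, b, c⟩, hf⟩, hx, hk⟩ := Nat.sInf_mem hne
    have hmin' : ∀ f : D, Quot.mk r f = x → a.natDegree ≤ f.1.1.natDegree :=
      fun f hf => hk.le.trans (Nat.sInf_le ⟨f, hf, rfl⟩)
    have ha0 : a ≠ 0 := h0 _ hx
    have hf' : b ^ 2 - 4 * (a * c) = 4 * α := hf
    obtain ⟨b', c', hs, hba, hdisc⟩ : ∃ b' c' : F[X], ProperEquiv F (a, b, c) (a, b', c') ∧
        b'.degree < a.degree ∧ (a, b', c') ∈ D := by
      obtain ⟨t, e⟩ : ∃ t : F[X], b + 2 * a * t = b % a := by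
        refine ⟨-(C (2⁻¹ : F) * (b / a)), ?_⟩
        rw [EuclideanDomain.mod_eq_sub_mul_div]
        linear_combination (-a * (b / a)) * hC
      refine ⟨b + 2 * a * t, c + b * t + a * t ^ 2, quot_shift F h2 a b c t, ?_, ?_⟩
      · rw [e]
        exact EuclideanDomain.mod_lt b ha0
      · change (b + 2 * a * t) ^ 2 - 4 * (a * (c + b * t + a * t ^ 2)) = 4 * α
        rw [← hf']; ring
    have hdisc' : b' ^ 2 - 4 * (a * c') = 4 * α := hdisc
    have hx' : Quot.mk r ⟨(a, b', c'), hdisc⟩ = x := by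
      rw [← hx]
      exact (Quot.sound (r := r) (a := ⟨_, hf⟩) (b := ⟨_, hdisc⟩) hs).symm
    have hdisc2 : (c', -b', a) ∈ D := by
      change (-b') ^ 2 - 4 * (c' * a) = 4 * α
      rw [← hdisc']; ring
    have hx2 : Quot.mk r ⟨(c', -b', a), hdisc2⟩ = x := by
      rw [← hx']
      exact (Quot.sound (r := r) (a := ⟨_, hdisc⟩) (b := ⟨_, hdisc2⟩)
        (quot_swap F a b' c')).symm
    have hc0 : c' ≠ 0 := h0 _ hx2
    have hac : a.natDegree ≤ c'.natDegree := hmin' _ hx2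
    have hlt : (b' ^ 2).degree < (4 * (a * c')).degree := by
      rw [hdeg4]
      by_cases hb : b' = 0
      · rw [hb]
        simpa [bot_lt_iff_ne_bot] using ⟨ha0, hc0⟩
      · rw [degree_eq_natDegree (pow_ne_zero 2 hb), degree_eq_natDegree (mul_ne_zero ha0 hc0),
          natDegree_pow, natDegree_mul ha0 hc0]
        have := natDegree_lt_natDegree hb hba
        exact_mod_cast (by omega : 2 * b'.natDegree < a.natDegree + c'.natDegree)
    have hsum : a.natDegree + c'.natDegree = n := by
      have h := degree_sub_eq_right_of_degree_lt hlt
      rw [hdisc', hdeg4, hdeg4] at h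
      rw [← natDegree_mul ha0 hc0, hn]
      exact (natDegree_eq_of_degree_eq h).symm
    have had : a.degree ≤ n := by
      rw [degree_eq_natDegree ha0]
      exact_mod_cast (by omega : a.natDegree ≤ n)
    have hcd : c'.degree ≤ n := by
      rw [degree_eq_natDegree hc0]
      exact_mod_cast (by omega : c'.natDegree ≤ n)
    exact ⟨⟨⟨(a, b', c'), hdisc⟩, had, hba.le.trans had, hcd⟩, hx'⟩

end
end

section
/- The ideal class group of the ring 𝔽_3[x][y]/(y² − (x³ + x + 1)) — the affine coordinate ring of the elliptic curve y² = x³ + x + 1 over 𝔽_3, realized as AdjoinRoot(Y² − (X³ + X + 1)) over 𝔽_3[X] — is a cyclic group of order 4, i.e., it is isomorphic to ℤ/4ℤ. -/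
open Polynomial

namespace F3Aux

/-- Abstract quadratic extension `F[X] ⊕ F[X] y` with `y² = f`. -/
structure Quad {F R : Type*} [Field F] [CommRing R] (φ : F[X] →+* R) (y : R) (f : F[X]) : Prop where
  sq : y * y = φ f
  rep : ∀ z : R, ∃ p q : F[X], z = φ p + φ q * y
  ind : ∀ p q : F[X], φ p + φ q * y = 0 → p = 0 ∧ q = 0

variable {F R : Type*} [Field F] [CommRing R] [IsDomain R] {φ : F[X] →+* R} {y : R} {f : F[X]}

theorem Quad.inj (h : Quad φ y f) {p : F[X]} (hp : φ p = 0) : p = 0 :=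
  (h.ind p 0 (by simp [hp])).1

theorem Quad.norm_ne (h : Quad φ y f) {p q : F[X]} (hz : φ p + φ q * y ≠ 0) :
    p ^ 2 - q ^ 2 * f ≠ 0 := by
  intro h0
  have h1 : (φ p + φ q * y) * (φ p + φ (-q) * y) = 0 := by
    have := congrArg φ h0
    simp only [map_sub, map_mul, map_pow, map_zero, ← h.sq] at this
    rw [map_neg]
    linear_combination this
  rcases mul_eq_zero.1 h1 with h2 | h2
  · exact hz h2
  · obtain ⟨rfl, hq⟩ := h.ind _ _ h2
    rw [neg_eq_zero] at hq
    subst hq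
    simp at hz

theorem Quad.hnf (h : Quad φ y f) (I : Ideal R) (hI : I ≠ ⊥) :
    ∃ d a b : F[X], d ≠ 0 ∧ a ≠ 0 ∧ a ∣ b ^ 2 - f ∧
      I = Ideal.span {φ d} * Ideal.span {φ a, φ b + y} := by
  let J : Ideal F[X] :=
    { carrier := {q | ∃ p, φ p + φ q * y ∈ I}
      add_mem' := by
        rintro q q' ⟨p, hp⟩ ⟨p', hp'⟩
        refine ⟨p + p', ?_⟩
        have := I.add_mem hp hp'
        convert this using 1
        simp only [map_add]; ring
      zero_mem' := ⟨0, by simp⟩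
      smul_mem' := by
        rintro c q ⟨p, hp⟩
        refine ⟨c * p, ?_⟩
        have := I.mul_mem_left (φ c) hp
        convert this using 1
        simp only [map_mul, smul_eq_mul]; ring }
  have hJ : ∀ q, q ∈ J ↔ ∃ p, φ p + φ q * y ∈ I := fun q => Iff.rfl
  obtain ⟨d, hd⟩ := (IsPrincipalIdealRing.principal J).principal
  obtain ⟨c, hc⟩ := (IsPrincipalIdealRing.principal (I.comap φ)).principal
  have hJd : ∀ q, q ∈ J ↔ d ∣ q := fun q => by
    rw [hd]; exact Ideal.mem_span_singleton
  have hIc : ∀ q, φ q ∈ I ↔ c ∣ q := fun q => by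
    rw [← Ideal.mem_comap, hc]; exact Ideal.mem_span_singleton
  have hcI : φ c ∈ I := (hIc c).2 dvd_rfl
  have hc0 : c ≠ 0 := by
    obtain ⟨z, hz, hz0⟩ := Submodule.exists_mem_ne_zero_of_ne_bot hI
    obtain ⟨p, q, rfl⟩ := h.rep z
    have h1 := h.norm_ne hz0
    have h2 : φ (p ^ 2 - q ^ 2 * f) ∈ I := by
      have := I.mul_mem_left (φ p - φ q * y) hz
      convert this using 1
      simp only [map_sub, map_mul, map_pow, ← h.sq]; ring
    rw [hIc] at h2
    rintro rfl
    exact h1 (zero_dvd_iff.1 h2)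
  obtain ⟨a, rfl⟩ : d ∣ c := by
    rw [← hJd, hJ]
    exact ⟨0, by simpa using I.mul_mem_right y hcI⟩
  obtain ⟨p0, hp0⟩ := (hJ d).1 ((hJd d).2 dvd_rfl)
  obtain ⟨b, rfl⟩ : d ∣ p0 := by
    rw [← hJd, hJ]
    refine ⟨d * f, ?_⟩
    have := I.mul_mem_left y hp0
    convert this using 1
    simp only [map_mul, ← h.sq]; ring
  have hd0 : d ≠ 0 := left_ne_zero_of_mul hc0
  refine ⟨d, a, b, hd0, right_ne_zero_of_mul hc0, ?_, ?_⟩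
  · have : φ (d * (b ^ 2 - f)) ∈ I := by
      have := I.mul_mem_left (φ b - y) hp0
      convert this using 1
      simp only [map_mul, map_sub, map_pow, ← h.sq]; ring
    rw [hIc] at this
    exact (mul_dvd_mul_iff_left hd0).1 this
  · apply le_antisymm
    · intro z hz
      obtain ⟨p, q, rfl⟩ := h.rep z
      obtain ⟨k, rfl⟩ : d ∣ q := by
        rw [← hJd, hJ]; exact ⟨p, hz⟩
      have h2 : φ (p - k * d * b) ∈ I := by
        have := I.sub_mem hz (I.mul_mem_left (φ k) hp0)
        convert this using 1
        simp only [map_mul, map_sub]; ring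
      rw [hIc] at h2
      obtain ⟨m, hm⟩ := h2
      rw [Ideal.mem_span_singleton_mul]
      refine ⟨φ m * φ a + φ k * (φ b + y), ?_, ?_⟩
      · exact Ideal.mem_span_pair.2 ⟨_, _, rfl⟩
      · have := congrArg φ hm
        simp only [map_mul, map_sub] at this ⊢
        linear_combination -this
    · rw [Ideal.span_singleton_mul_le_iff]
      intro z hz
      obtain ⟨s, t, rfl⟩ := Ideal.mem_span_pair.1 hz
      have := I.add_mem (I.mul_mem_left s hcI) (I.mul_mem_left t hp0)
      convert this using 1
      simp only [map_mul]; ring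

/-- Two ideals define the same class. -/
def Rel (I J : Ideal R) : Prop :=
  ∃ x y : R, x ≠ 0 ∧ y ≠ 0 ∧ Ideal.span {x} * I = Ideal.span {y} * J

theorem Rel.trans {I J K : Ideal R} (h : Rel I J) (h' : Rel J K) : Rel I K := by
  obtain ⟨x, y, hx, hy, e⟩ := h
  obtain ⟨x', y', hx', hy', e'⟩ := h'
  refine ⟨x' * x, y * y', mul_ne_zero hx' hx, mul_ne_zero hy hy', ?_⟩
  rw [← Ideal.span_singleton_mul_span_singleton, ← Ideal.span_singleton_mul_span_singleton,
    mul_assoc, e, mul_left_comm, e', mul_assoc]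

theorem Quad.modify (a b k : F[X]) :
    Ideal.span {φ a, φ (b - a * k) + y} = Ideal.span {φ a, φ b + y} := by
  have : φ (b - a * k) + y = φ b + y + (- φ k) * φ a := by
    simp only [map_sub, map_mul]; ring
  rw [this, Ideal.span_pair_add_mul_left]

theorem Quad.flip (h : Quad φ y f) (a b a' : F[X]) (ha : a ≠ 0) (e : b ^ 2 - f = a * a') :
    Rel (Ideal.span {φ a, φ b + y}) (Ideal.span {φ a', φ (-b) + y}) := by
  refine ⟨φ (-b) + y, φ a, ?_, fun h0 => ha (h.inj h0), ?_⟩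
  · intro h0
    have := h.ind (-b) 1 (by simpa using h0)
    exact one_ne_zero this.2
  · have e' : (φ (-b) + y) * (φ b + y) = - (φ a * φ a') := by
      have := congrArg φ e
      simp only [map_mul, map_sub, map_pow, ← h.sq, map_neg] at this ⊢
      linear_combination -this
    rw [Ideal.span_mul_span', Ideal.span_mul_span', Set.singleton_mul, Set.singleton_mul,
      Set.image_pair, Set.image_pair, e', mul_comm (φ (-b) + y), Set.pair_comm,
      Ideal.span_insert, Ideal.span_singleton_neg, ← Ideal.span_insert]

theorem Quad.reduce (h : Quad φ y f) (hf : f.natDegree ≤ 3) (n : ℕ) :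
    ∀ a b : F[X], a ≠ 0 → a.natDegree = n → a ∣ b ^ 2 - f →
      Rel (Ideal.span {φ a, φ b + y}) ⊤ ∨
      ∃ s t : F, t ^ 2 = f.eval s ∧
        Rel (Ideal.span {φ a, φ b + y}) (Ideal.span {φ (X - C s), y - φ (C t)}) := by
  induction n using Nat.strong_induction_on with
  | _ n ih =>
  intro a b ha hn hab
  by_cases hn0 : n = 0
  · left
    refine ⟨1, 1, one_ne_zero, one_ne_zero, ?_⟩
    congr 1
    rw [hn0] at hn
    apply Ideal.eq_top_of_isUnit_mem (x := φ a) _ (Ideal.subset_span (by simp))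
    apply IsUnit.map
    rw [isUnit_iff_degree_eq_zero, degree_eq_natDegree ha, hn]; rfl
  -- reduce b modulo a
  obtain ⟨b', k, hb', hdeg⟩ : ∃ b' k, b' = b - a * k ∧ b'.natDegree < n := by
    refine ⟨b % a, b / a, ?_, ?_⟩
    · rw [eq_sub_iff_add_eq]; exact EuclideanDomain.mod_add_div b a
    · rw [← hn]
      exact natDegree_mod_lt b (by omega)
  have hab' : a ∣ b' ^ 2 - f := by
    have : b' ^ 2 - f = (b ^ 2 - f) + a * (k * (a * k - 2 * b)) := by rw [hb']; ring
    rw [this]; exact dvd_add hab (dvd_mul_right _ _)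
  rw [← Quad.modify a b k, ← hb']
  by_cases hn1 : n = 1
  · right
    have hd1 : a.degree = 1 := by rw [degree_eq_natDegree ha, hn, hn1]; rfl
    obtain ⟨s, hs⟩ := exists_root_of_degree_eq_one hd1
    obtain ⟨m, hm⟩ := dvd_iff_isRoot.2 hs
    obtain ⟨t, ht⟩ := natDegree_eq_zero.1 (show b'.natDegree = 0 by omega)
    refine ⟨s, -t, ?_, 1, 1, one_ne_zero, one_ne_zero, ?_⟩
    · obtain ⟨l, hl⟩ := hab'
      have := congrArg (eval s) hl
      rw [eval_mul, hs.eq_zero, ← ht] at this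
      simp at this
      rw [neg_sq]
      exact sub_eq_zero.1 this
    · congr 1
      have hmu : IsUnit m := by
        have hm0 : m ≠ 0 := by rintro rfl; simp at hm; exact ha hm
        have := congrArg natDegree hm
        rw [natDegree_mul (X_sub_C_ne_zero s) hm0, natDegree_X_sub_C] at this
        rw [isUnit_iff_degree_eq_zero, degree_eq_natDegree hm0,
          show m.natDegree = 0 by omega]; rfl
      rw [hm, map_mul, Ideal.span_insert, Ideal.span_singleton_mul_right_unit (hmu.map φ),
        ← Ideal.span_insert, ← ht]
      congr 3
      simp only [C_neg, map_neg]; ring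
  obtain ⟨a', e⟩ := hab'
  have hne : b' ^ 2 - f ≠ 0 := by
    have := h.norm_ne (p := b') (q := 1) (fun h0 => one_ne_zero (h.ind _ _ h0).2)
    simpa using this
  have ha' : a' ≠ 0 := by rintro rfl; simp at e; exact hne e
  have hda : a'.natDegree < n := by
    have h1 := congrArg natDegree e
    rw [natDegree_mul ha ha', hn] at h1
    have h2 := natDegree_sub_le (b' ^ 2) f
    rw [natDegree_pow] at h2
    rcases le_max_iff.1 h2 with h3 | h3 <;> omega
  have hr := h.flip a b' a' ha e
  rcases ih _ hda a' (-b') ha' rfl ⟨a, by rw [neg_sq, e, mul_comm]⟩ with h1 | ⟨s, t, hst, h1⟩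
  · exact Or.inl (hr.trans h1)
  · exact Or.inr ⟨s, t, hst, hr.trans h1⟩

theorem Quad.classify (h : Quad φ y f) (hf : f.natDegree ≤ 3) (I : Ideal R) (hI : I ≠ ⊥) :
      Rel I ⊤ ∨ ∃ s t : F, t ^ 2 = f.eval s ∧
        Rel I (Ideal.span {φ (X - C s), y - φ (C t)}) := by
  obtain ⟨d, a, b, hd, ha, hab, e⟩ := h.hnf I hI
  have hr : Rel I (Ideal.span {φ a, φ b + y}) :=
    ⟨1, φ d, one_ne_zero, fun h0 => hd (h.inj h0), by
      rw [Ideal.span_singleton_one, Ideal.top_mul, e]⟩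
  rcases h.reduce hf _ a b ha rfl hab with h1 | ⟨s, t, hst, h1⟩
  · exact Or.inl (hr.trans h1)
  · exact Or.inr ⟨s, t, hst, hr.trans h1⟩

/-- The curve `y² = x³ + x + 1`. -/
abbrev E : WeierstrassCurve.Affine (ZMod 3) := ⟨0, 0, 0, 1, 1⟩

instance : E.IsElliptic := ⟨by
  rw [isUnit_iff_ne_zero]
  decide⟩

open WeierstrassCurve.Affine

theorem quadE : Quad ((CoordinateRing.mk E).comp C) (CoordinateRing.mk E X)
    (X ^ 3 + X + 1 : (ZMod 3)[X]) where
  sq := by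
    have := CoordinateRing.smul_basis_mul_Y (W' := E) 0 1
    simpa [CoordinateRing.smul] using this
  rep z := by
    obtain ⟨p, q, h⟩ := CoordinateRing.exists_smul_basis_eq z
    exact ⟨p, q, by rw [← h, CoordinateRing.smul, CoordinateRing.smul, mul_one]; rfl⟩
  ind p q h := by
    apply CoordinateRing.smul_basis_eq_zero (W' := E)
    rw [CoordinateRing.smul, CoordinateRing.smul, mul_one]; exact h

theorem toClass_surj : Function.Surjective (Point.toClass (W := E)) := by
  intro c
  induction c using Additive.rec with | _ c
  refine ClassGroup.induction (R := E.CoordinateRing) (K := FractionRing E.CoordinateRing)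
    (P := fun c => ∃ a, Point.toClass (W := E) a = Additive.ofMul c) (fun I => ?_) c
  obtain ⟨u, hu⟩ := FractionalIdeal.isUnit_num.2 I.isUnit
  have huI : ClassGroup.mk (FractionRing E.CoordinateRing) I =
      ClassGroup.mk (FractionRing E.CoordinateRing) u := by
    rw [ClassGroup.mk_eq_mk]
    have fd_ne_zero : (algebraMap E.CoordinateRing (FractionRing E.CoordinateRing)) I.1.den ≠ 0 :=
      IsFractionRing.to_map_ne_zero_of_mem_nonZeroDivisors (SetLike.coe_mem _)
    refine ⟨Units.mk0 _ fd_ne_zero, ?_⟩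
    apply Units.ext
    rw [hu, mul_comm, Units.val_mul, coe_toPrincipalIdeal, Units.val_mk0]
    exact FractionalIdeal.den_mul_self_eq_num' _ (FractionRing E.CoordinateRing) I.1
  have hne : I.1.num ≠ ⊥ := by
    intro h0
    rw [h0] at hu
    exact u.ne_zero (by simpa using hu)
  have hf : (X ^ 3 + X + 1 : (ZMod 3)[X]).natDegree ≤ 3 := by compute_degree
  rw [huI]
  rcases quadE.classify hf _ hne with h | ⟨s, t, hst, h⟩
  · refine ⟨0, ?_⟩
    have := (ClassGroup.mk_eq_mk_of_coe_ideal hu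
      (J := 1) (by simp)).2 h
    rw [this, map_one, map_zero]; rfl
  · have heq : E.Equation s t := by
      rw [equation_iff]
      simp at hst ⊢
      exact hst
    have hns : E.Nonsingular s t := (equation_iff_nonsingular).1 heq
    refine ⟨.some s t hns, ?_⟩
    rw [Point.toClass_some]
    refine ((ClassGroup.mk_eq_mk_of_coe_ideal hu (CoordinateRing.XYIdeal'_eq hns)).2 ?_).symm
    convert h using 5
    simp only [CoordinateRing.XYIdeal, CoordinateRing.XClass, CoordinateRing.YClass, map_sub]
    rfl

theorem card_point : Nat.card E.Point = 4 := by
  rw [Nat.card_congr (pointEquiv E)]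
  have : Nat.card {xy : ZMod 3 × ZMod 3 // E.Equation xy.1 xy.2} = 3 := by
    have e : {xy : ZMod 3 × ZMod 3 // E.Equation xy.1 xy.2} ≃
        {xy : ZMod 3 × ZMod 3 // xy.2 ^ 2 = xy.1 ^ 3 + xy.1 + 1} :=
      Equiv.subtypeEquivRight (fun xy => by rw [equation_iff]; simp)
    rw [Nat.card_congr e, Nat.card_eq_fintype_card]
    decide
  change Nat.card (Option _) = 4
  rw [Finite.card_option, this]

theorem cyclic_point : IsAddCyclic E.Point := by
  have heq : E.Equation 0 1 := by
    rw [equation_iff]; simp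
  have hns : E.Nonsingular 0 1 := (equation_iff_nonsingular).1 heq
  have : Finite E.Point := Nat.finite_of_card_ne_zero (by rw [card_point]; decide)
  apply isAddCyclic_of_addOrderOf_eq_card (Point.some 0 1 hns)
  rw [card_point]
  refine addOrderOf_eq_prime_pow (p := 2) (n := 1) ?_ ?_
  · intro h
    rw [pow_one, two_nsmul, add_eq_zero_iff_eq_neg, Point.neg_some] at h
    injection h with _ h
    revert h
    simp [negY]
    decide
  · have := card_nsmul_eq_zero' (x := Point.some 0 1 hns)
    rwa [card_point] at this

theorem main (p : (ZMod 3)[X][X]) (hp : p = E.polynomial) [IsDomain (AdjoinRoot p)] :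
    Nonempty (ClassGroup (AdjoinRoot p) ≃* Multiplicative (ZMod 4)) := by
  subst hp
  have e1 : E.Point ≃+ Additive (ClassGroup E.CoordinateRing) :=
    AddEquiv.ofBijective _ ⟨Point.toClass_injective, toClass_surj⟩
  have := cyclic_point
  have e2 : E.Point ≃+ ZMod 4 := addEquivOfAddCyclicCardEq (by rw [card_point]; simp)
  exact ⟨AddEquiv.toMultiplicativeRight (e1.symm.trans e2)⟩

end F3Aux

/-- **Example over `𝔽₃`**: the ideal class group of the affine coordinate ring
`𝔽₃[x][y]/(y² - (x³ + x + 1))` of the elliptic curve `y² = x³ + x + 1` over `𝔽₃`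
is cyclic of order 4. -/
theorem classgroup_F3_elliptic_cyclic_four
    [IsDomain (AdjoinRoot ((Polynomial.X : Polynomial (Polynomial (ZMod 3))) ^ 2 -
      Polynomial.C (Polynomial.X ^ 3 + Polynomial.X + 1)))] :
    Nonempty (ClassGroup (AdjoinRoot
        ((Polynomial.X : Polynomial (Polynomial (ZMod 3))) ^ 2 -
          Polynomial.C (Polynomial.X ^ 3 + Polynomial.X + 1))) ≃*
      Multiplicative (ZMod 4)) := by
  apply F3Aux.main
  simp [WeierstrassCurve.Affine.polynomial]
end

section
/- The ideal class group of the ring 𝔽_5[x][y]/(y² − (x³ + x)) — the affine coordinate ring of the elliptic curve y² = x³ + x over 𝔽_5, realized as AdjoinRoot(Y² − (X³ + X)) over 𝔽_5[X] — is isomorphic to the Klein four-group ℤ/2ℤ × ℤ/2ℤ; in particular it has order 4 and exponent 2. -/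
open Polynomial

namespace ECClass
open WeierstrassCurve WeierstrassCurve.Affine nonZeroDivisors

variable {F : Type} [Field F] (W : WeierstrassCurve.Affine F)

lemma finite_quot {I : Ideal W.CoordinateRing} (hI : I ≠ ⊥) :
    FiniteDimensional F (W.CoordinateRing ⧸ I) := by
  have h := fun i => PowerBasis.finite (AdjoinRoot.powerBasis
    (I.smithCoeffs_ne_zero (CoordinateRing.basis W) hI i))
  have : ∀ i, FiniteDimensional F
    (F[X] ⧸ Ideal.span ({I.smithCoeffs (CoordinateRing.basis W) hI i} : Set F[X])) := h
  exact Module.Finite.equiv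
    ((I.quotientEquivPiSpan (CoordinateRing.basis W) hI).restrictScalars F).symm

lemma exists_small {I : Ideal W.CoordinateRing} (hI : I ≠ ⊥) :
    ∃ f ∈ I, f ≠ 0 ∧ Module.finrank F (W.CoordinateRing ⧸ Ideal.span {f}) ≤
      Module.finrank F (W.CoordinateRing ⧸ I) + 1 := by
  have := finite_quot W hI
  set d := Module.finrank F (W.CoordinateRing ⧸ I) with hd
  let φ : (degreeLT F ((d + 1) / 2 + 1) × degreeLT F (d / 2)) →ₗ[F] W.CoordinateRing :=
    LinearMap.coprod
      (((LinearMap.toSpanSingleton F[X] W.CoordinateRing 1).restrictScalars F).comp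
        (degreeLT F ((d + 1) / 2 + 1)).subtype)
      (((LinearMap.toSpanSingleton F[X] W.CoordinateRing
        (CoordinateRing.mk W X)).restrictScalars F).comp (degreeLT F (d / 2)).subtype)
  have e1 : ∀ n, Module.finrank F (degreeLT F n) = n := fun n => by
    rw [(degreeLTEquiv F n).finrank_eq]; simp
  have fin : ∀ n, FiniteDimensional F (degreeLT F n) := fun n =>
    Module.Finite.equiv (degreeLTEquiv F n).symm
  have hk := LinearMap.ker_ne_bot_of_finrank_lt
    (f := (Ideal.Quotient.mkₐ F I).toLinearMap.comp φ) (by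
      rw [Module.finrank_prod, e1, e1, ← hd]; lia)
  obtain ⟨⟨⟨p, hp⟩, ⟨q, hq⟩⟩, hx, hx0⟩ := (Submodule.ne_bot_iff _).mp hk
  have hx' : p • (1 : W.CoordinateRing) + q • CoordinateRing.mk W X ∈ I := by
    have : Ideal.Quotient.mk I (p • (1 : W.CoordinateRing) + q • CoordinateRing.mk W X) = 0 := hx
    rwa [Ideal.Quotient.eq_zero_iff_mem] at this
  have hne : p • (1 : W.CoordinateRing) + q • CoordinateRing.mk W X ≠ 0 := by
    intro h
    obtain ⟨rfl, rfl⟩ := CoordinateRing.smul_basis_eq_zero h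
    exact hx0 rfl
  refine ⟨_, hx', hne, ?_⟩
  rw [finrank_quotient_span_eq_natDegree_norm (CoordinateRing.basis W) hne]
  apply natDegree_le_of_degree_le
  rw [CoordinateRing.degree_norm_smul_basis]
  rw [mem_degreeLT] at hp hq
  apply max_le
  · rcases h : p.degree with _ | n
    · exact bot_le
    · rw [h] at hp
      have : n < (d + 1) / 2 + 1 := WithBot.coe_lt_coe.mp hp
      exact WithBot.coe_le_coe.mpr (by dsimp; lia)
  · rcases h : q.degree with _ | n
    · exact bot_le
    · rw [h] at hq
      have : n < d / 2 := WithBot.coe_lt_coe.mp hq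
      exact WithBot.coe_le_coe.mpr (by dsimp; lia)

lemma exists_gen {I : Ideal W.CoordinateRing} (hI : I ≠ ⊥) :
    ∃ f ∈ I, f ≠ 0 ∧ ∃ v ∈ I, ∀ w ∈ I, ∃ c : F, w - c • v ∈ Ideal.span {f} := by
  obtain ⟨f, hf, hf0, hle⟩ := exists_small W hI
  refine ⟨f, hf, hf0, ?_⟩
  have hfI : Ideal.span {f} ≤ I := (Ideal.span_singleton_le_iff_mem _).mpr hf
  have := finite_quot W hI
  have := finite_quot W (I := Ideal.span {f}) (by simpa using hf0)
  let φ : (W.CoordinateRing ⧸ Ideal.span {f}) →ₗ[F] (W.CoordinateRing ⧸ I) :=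
    (Ideal.Quotient.factorₐ F hfI).toLinearMap
  have hs : Function.Surjective φ := Ideal.Quotient.factor_surjective hfI
  have h1 := φ.finrank_range_add_finrank_ker
  rw [LinearMap.range_eq_top.mpr hs, finrank_top] at h1
  obtain ⟨⟨v, hv⟩, hvw⟩ := finrank_le_one_iff.mp (show Module.finrank F (LinearMap.ker φ) ≤ 1 by lia)
  obtain ⟨v, rfl⟩ := Ideal.Quotient.mk_surjective v
  have key : ∀ w, φ (Ideal.Quotient.mk _ w) = Ideal.Quotient.mk _ w := fun w => rfl
  refine ⟨v, ?_, fun w hw => ?_⟩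
  · rwa [LinearMap.mem_ker, key, Ideal.Quotient.eq_zero_iff_mem] at hv
  · obtain ⟨c, hc⟩ := hvw ⟨Ideal.Quotient.mk _ w, by
      rwa [LinearMap.mem_ker, key, Ideal.Quotient.eq_zero_iff_mem]⟩
    refine ⟨c, ?_⟩
    have hc' := congrArg Subtype.val hc
    rw [← Ideal.Quotient.eq_zero_iff_mem, map_sub, sub_eq_zero]
    exact hc'.symm

lemma exists_point {I : Ideal W.CoordinateRing} (hI : I ≠ ⊥) :
    ∃ f, f ≠ 0 ∧ Ideal.span {f} ≤ I ∧ (I = Ideal.span {f} ∨ ∃ a b, W.Equation a b ∧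
      CoordinateRing.XYIdeal W a (C b) * I ≤ Ideal.span {f}) := by
  obtain ⟨f, hf, hf0, v, hv, h⟩ := exists_gen W hI
  have hfI : Ideal.span {f} ≤ I := (Ideal.span_singleton_le_iff_mem _).mpr hf
  refine ⟨f, hf0, hfI, ?_⟩
  -- every element acts on `I/(f)` by a scalar
  have act : ∀ r : W.CoordinateRing, ∃ c : F, ∀ w ∈ I,
      (r - algebraMap F _ c) * w ∈ Ideal.span {f} := by
    intro r
    obtain ⟨c, hc⟩ := h (r * v) (I.mul_mem_left _ hv)
    refine ⟨c, fun w hw => ?_⟩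
    obtain ⟨e, he⟩ := h w hw
    have := add_mem (Ideal.mul_mem_left _ (r - algebraMap F _ c) he)
      (Ideal.mul_mem_left _ (algebraMap F _ e) hc)
    convert this using 1
    simp only [Algebra.smul_def]
    ring
  obtain ⟨a, ha⟩ := act (CoordinateRing.mk W (C X))
  obtain ⟨b, hb⟩ := act (CoordinateRing.mk W X)
  have hM : CoordinateRing.XYIdeal W a (C b) * I ≤ Ideal.span {f} := by
    rw [Ideal.mul_le]
    intro r hr w hw
    obtain ⟨s, t, rfl⟩ := Ideal.mem_span_pair.mp hr
    have := add_mem (Ideal.mul_mem_left _ s (ha w hw)) (Ideal.mul_mem_left _ t (hb w hw))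
    convert this using 1
    have e1 : CoordinateRing.XClass W a = CoordinateRing.mk W (C X) - algebraMap F _ a := by
      simp only [CoordinateRing.XClass, map_sub]; rfl
    have e2 : CoordinateRing.YClass W (C b) = CoordinateRing.mk W X - algebraMap F _ b := by
      simp only [CoordinateRing.YClass, map_sub]; rfl
    rw [e1, e2]
    ring
  by_cases hW : W.Equation a b
  · exact Or.inr ⟨a, b, hW, hM⟩
  · left
    have hmem : W.polynomial - C (C (W.polynomial.evalEval a b)) ∈
        Ideal.span {C (X - C a), X - C (C b)} := by
      rw [mem_span_C_X_sub_C_X_sub_C_iff_eval_eval_eq_zero]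
      simp [evalEval]
    have h2 := Ideal.mem_map_of_mem (CoordinateRing.mk W) hmem
    rw [Ideal.map_span, Set.image_pair, map_sub (CoordinateRing.mk W) W.polynomial,
      AdjoinRoot.mk_self, zero_sub, neg_mem_iff] at h2
    have h3 : CoordinateRing.XYIdeal W a (C b) = ⊤ := by
      refine Ideal.eq_top_of_isUnit_mem _ h2 ?_
      exact (((isUnit_iff_ne_zero.mpr hW).map C).map C).map (CoordinateRing.mk W)
    rw [h3, Ideal.top_mul] at hM
    exact le_antisymm hM hfI

lemma isMaximal {a b : F} (h : W.Equation a b) :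
    (CoordinateRing.XYIdeal W a (C b)).IsMaximal :=
  Ideal.Quotient.maximal_of_isField _
    ((CoordinateRing.quotientXYIdealEquiv h).toMulEquiv.isField (Field.toIsField F))

theorem surj [DecidableEq F] [W.IsElliptic] :
    Function.Surjective (Point.toClass (W := W)) := by
  suffices H : ∀ U : (FractionalIdeal W.CoordinateRing⁰ W.FunctionField)ˣ,
      ∃ P : W.Point, (Point.toClass P).toMul * ClassGroup.mk W.FunctionField U = 1 by
    intro c
    refine ClassGroup.induction (P := fun c => ∃ P : W.Point, Point.toClass P = Additive.ofMul c)
      W.FunctionField (fun U => ?_) c.toMul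
    obtain ⟨P, hP⟩ := H U
    refine ⟨-P, ?_⟩
    rw [map_neg]
    exact (eq_inv_of_mul_eq_one_right hP).symm
  intro V
  -- reduce to an integral ideal
  obtain ⟨U, I, hUI, hUV⟩ : ∃ (U : (FractionalIdeal W.CoordinateRing⁰ W.FunctionField)ˣ)
      (I : Ideal W.CoordinateRing), (U : FractionalIdeal W.CoordinateRing⁰ W.FunctionField) = I ∧
      ClassGroup.mk W.FunctionField V = ClassGroup.mk W.FunctionField U := by
    have h0 : algebraMap W.CoordinateRing W.FunctionField V.1.den ≠ 0 :=
      IsFractionRing.to_map_ne_zero_of_mem_nonZeroDivisors V.1.den.prop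
    refine ⟨V * toPrincipalIdeal _ _ (Units.mk0 _ h0), V.1.num, ?_, ?_⟩
    · rw [mul_comm, Units.val_mul, coe_toPrincipalIdeal, Units.val_mk0]
      exact FractionalIdeal.den_mul_self_eq_num' _ _ _
    · exact ClassGroup.mk_eq_mk.mpr ⟨_, rfl⟩
  rw [hUV]
  have hI : I ≠ ⊥ := by
    rintro rfl
    exact U.ne_zero (by rw [hUI, FractionalIdeal.coeIdeal_bot])
  obtain ⟨f, hf0, hfI, rfl | ⟨a, b, hab, hM⟩⟩ := exists_point W hI
  · refine ⟨0, ?_⟩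
    rw [(ClassGroup.mk_eq_one_of_coe_ideal hUI).mpr ⟨f, hf0, rfl⟩, map_zero, toMul_zero, mul_one]
  by_cases hIf : I = Ideal.span {f}
  · refine ⟨0, ?_⟩
    rw [(ClassGroup.mk_eq_one_of_coe_ideal hUI).mpr ⟨f, hf0, hIf⟩, map_zero, toMul_zero, mul_one]
  have hns : W.Nonsingular a b := equation_iff_nonsingular.mp hab
  refine ⟨Point.some a b hns, ?_⟩
  rw [Point.toClass_some]
  refine (map_mul (ClassGroup.mk W.FunctionField) (CoordinateRing.XYIdeal' hns) U).symm.trans ?_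
  have hc : ((CoordinateRing.XYIdeal' hns * U :
      (FractionalIdeal W.CoordinateRing⁰ W.FunctionField)ˣ) :
      FractionalIdeal W.CoordinateRing⁰ W.FunctionField) =
      (CoordinateRing.XYIdeal W a (C b) * I : Ideal _) := by
    rw [Units.val_mul, hUI, FractionalIdeal.coeIdeal_mul, CoordinateRing.XYIdeal'_eq]
  refine (ClassGroup.mk_eq_one_of_coe_ideal hc).mpr ⟨f, hf0, ?_⟩
  set M := CoordinateRing.XYIdeal W a (C b) with hMdef
  have hmax : M.IsMaximal := isMaximal W hab
  let s : FractionalIdeal W.CoordinateRing⁰ W.FunctionField := (Ideal.span {f} : Ideal _)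
  let Ui : FractionalIdeal W.CoordinateRing⁰ W.FunctionField := (U⁻¹ : _ˣ)
  have hUU : (I : FractionalIdeal W.CoordinateRing⁰ W.FunctionField) * Ui = 1 := by
    rw [← hUI]; exact U.mul_inv
  have h1 : s * Ui ≤ 1 := by
    rw [← hUU]
    exact mul_le_mul_left (FractionalIdeal.coeIdeal_le_coeIdeal _ |>.mpr hfI) _
  obtain ⟨N, hN⟩ := FractionalIdeal.le_one_iff_exists_coeIdeal.mp h1
  have hNI : N * I = Ideal.span {f} := by
    apply FractionalIdeal.coeIdeal_injective (K := W.FunctionField)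
    beta_reduce
    rw [FractionalIdeal.coeIdeal_mul, hN, mul_assoc, mul_comm Ui, hUU, mul_one]
  have hMN : M ≤ N := by
    rw [← FractionalIdeal.coeIdeal_le_coeIdeal W.FunctionField, hN,
      ← mul_one (M : FractionalIdeal W.CoordinateRing⁰ W.FunctionField), ← hUU, ← mul_assoc,
      ← FractionalIdeal.coeIdeal_mul]
    exact mul_le_mul_left (FractionalIdeal.coeIdeal_le_coeIdeal _ |>.mpr hM) _
  have hNt : N ≠ ⊤ := by
    rintro rfl
    exact hIf (by rw [← hNI, Ideal.top_mul])
  rw [hmax.eq_of_le hNt hMN, hNI]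

/-- The curve `y² = x³ + x` over `𝔽₅`. -/
def E : WeierstrassCurve.Affine (ZMod 5) := ⟨0, 0, 0, 1, 0⟩

theorem fact_five : Fact (Nat.Prime 5) := ⟨by norm_num⟩

attribute [local instance] fact_five

instance : E.IsElliptic := ⟨by
  rw [isUnit_iff_ne_zero]
  simp only [WeierstrassCurve.Δ, WeierstrassCurve.b₂, WeierstrassCurve.b₄, WeierstrassCurve.b₆,
    WeierstrassCurve.b₈, E]
  decide⟩

lemma E_eq (x y : ZMod 5) : E.Equation x y ↔ y ^ 2 = x ^ 3 + x := by
  rw [Affine.equation_iff]; simp [E]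

lemma card_E : Nat.card E.Point = 4 := by
  rw [Nat.card_congr E.pointEquiv]
  have : Nat.card {xy : ZMod 5 × ZMod 5 // E.Equation xy.1 xy.2} = 3 := by
    rw [Nat.card_congr (Equiv.subtypeEquivRight fun xy : ZMod 5 × ZMod 5 => E_eq xy.1 xy.2),
      Nat.card_eq_fintype_card]
    decide
  have hf : Finite {xy : ZMod 5 × ZMod 5 // E.Equation xy.1 xy.2} := inferInstance
  exact (Finite.card_option).trans (by rw [this])

lemma two_E (P : E.Point) : P + P = 0 := by
  rcases P with _ | ⟨x, y, h⟩
  · exact add_zero 0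
  · apply Point.add_self_of_Y_eq
    have h1 := (E_eq x y).mp h.1
    have : ∀ x y : ZMod 5, y ^ 2 = x ^ 3 + x → y = 0 := by decide
    simp [negY, E, this x y h1]

lemma E_poly : E.polynomial = X ^ 2 - C (X ^ 3 + X) := by
  simp [WeierstrassCurve.Affine.polynomial, E]

theorem main_E : Nonempty (ClassGroup E.CoordinateRing ≃*
    Multiplicative (ZMod 2) × Multiplicative (ZMod 2)) := by
  let e : E.Point ≃+ Additive (ClassGroup E.CoordinateRing) :=
    AddEquiv.ofBijective Point.toClass ⟨Point.toClass_injective, surj E⟩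
  have hcard : Nat.card (ClassGroup E.CoordinateRing) = 4 :=
    (Nat.card_congr e.toEquiv).symm.trans card_E
  have hsq : ∀ c : ClassGroup E.CoordinateRing, c ^ 2 = 1 := by
    intro c
    obtain ⟨P, hP⟩ := surj E (Additive.ofMul c)
    have := congrArg (Point.toClass (W := E)) (two_E P)
    rw [map_add, hP, map_zero] at this
    rw [sq]
    exact this
  have k : IsKleinFour (ClassGroup E.CoordinateRing) := ⟨hcard, by
    have hd := Monoid.exponent_dvd_of_forall_pow_eq_one hsq
    rcases (Nat.dvd_prime Nat.prime_two).mp hd with h | h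
    · have := (Monoid.exp_eq_one_iff.mp h)
      rw [Nat.card_of_subsingleton 1] at hcard
      simp at hcard
    · exact h⟩
  obtain ⟨g⟩ := IsKleinFour.nonempty_mulEquiv (G₁ := ClassGroup E.CoordinateRing)
    (G₂ := Multiplicative (ZMod 2 × ZMod 2))
  exact ⟨g.trans (MulEquiv.prodMultiplicative _ _)⟩

theorem transfer (f : (ZMod 5)[X][X]) (hf : f = E.polynomial) [IsDomain (AdjoinRoot f)] :
    Nonempty (ClassGroup (AdjoinRoot f) ≃*
      Multiplicative (ZMod 2) × Multiplicative (ZMod 2)) := by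
  subst hf
  exact main_E

end ECClass


/-- **Example over `𝔽₅`**: the ideal class group of the affine coordinate ring
`𝔽₅[x][y]/(y² - (x³ + x))` of the elliptic curve `y² = x³ + x` over `𝔽₅` is the
Klein four-group `ℤ/2 × ℤ/2`. -/
theorem classgroup_F5_elliptic_klein_four
    [IsDomain (AdjoinRoot ((Polynomial.X : Polynomial (Polynomial (ZMod 5))) ^ 2 -
      Polynomial.C (Polynomial.X ^ 3 + Polynomial.X)))] :
    Nonempty (ClassGroup (AdjoinRoot
        ((Polynomial.X : Polynomial (Polynomial (ZMod 5))) ^ 2 -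
          Polynomial.C (Polynomial.X ^ 3 + Polynomial.X))) ≃*
      Multiplicative (ZMod 2) × Multiplicative (ZMod 2)) :=
  ECClass.transfer _ ECClass.E_poly.symm
end
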